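/- Let X be a completely regular (Hausdorff) topological space and let H be a subset of C_B(X) which separates points from closed sets in X, and let H̄ denote the closure of H in C_B(X) (with respect to the supremum norm). Then H̄ also separates points from closed sets in X, and the compactifications α_{H̄} X and α_H X coincide: there is a homeomorphism between α_{H̄} X and α_H X whose restriction to (the canonical copy of) X is the identity. -/

import Mathlib

open Set Topology

/-- `H ⊆ C_B(X)` separates points from closed sets in `X`. -/
def SeparatesPointsFromClosedSets {X : Type*} [TopologicalSpace X]
    (H : Set (BoundedContinuousFunction X ℂ)) : Prop :=
  ∀ C : Set X, IsClosed C → ∀ x ∉ C, ∃ h ∈ H, h x ∉ closure ((h : X → ℂ) '' C)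

/-- The evaluation map `e : X → ∏_{h ∈ H} cl_ℂ(h(X))`. -/
noncomputable def evalMap {X : Type*} [TopologicalSpace X]
    (H : Set (BoundedContinuousFunction X ℂ)) (x : X) :
    (h : H) → (closure (Set.range ((h : BoundedContinuousFunction X ℂ) : X → ℂ)) : Set ℂ) :=
  fun h => ⟨(h : BoundedContinuousFunction X ℂ) x, subset_closure ⟨x, rfl⟩⟩

/-- The compactification `α_H X`, as the closure of `e(X)` in the product. -/
noncomputable def alphaSet {X : Type*} [TopologicalSpace X]
    (H : Set (BoundedContinuousFunction X ℂ)) :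
    Set ((h : H) → (closure (Set.range ((h : BoundedContinuousFunction X ℂ) : X → ℂ)) : Set ℂ)) :=
  closure (Set.range (evalMap H))

/-- The corestriction `X → α_H X` of the evaluation map. -/
noncomputable def evalAlpha {X : Type*} [TopologicalSpace X]
    (H : Set (BoundedContinuousFunction X ℂ)) (x : X) : alphaSet H :=
  ⟨evalMap H x, subset_closure ⟨x, rfl⟩⟩

theorem SeparatesPointsFromClosedSets.mono {X : Type*} [TopologicalSpace X]
    {H G : Set (BoundedContinuousFunction X ℂ)} (hHG : H ⊆ G)
    (hH : SeparatesPointsFromClosedSets H) : SeparatesPointsFromClosedSets G := by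
  intro C hC x hx
  obtain ⟨h, hh, hxh⟩ := hH C hC x hx
  exact ⟨h, hHG hh, hxh⟩

theorem isCompact_closure_range_boundedContinuousFunction {X : Type*} [TopologicalSpace X]
    (h : BoundedContinuousFunction X ℂ) : IsCompact (closure (Set.range (h : X → ℂ))) :=
  h.isBounded_range.isCompact_closure

theorem compactSpace_alphaSet {X : Type*} [TopologicalSpace X]
    (H : Set (BoundedContinuousFunction X ℂ)) : CompactSpace (alphaSet H) := by
  have (h : H) : CompactSpace
      (closure (Set.range ((h : BoundedContinuousFunction X ℂ) : X → ℂ)) : Set ℂ) :=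
    isCompact_iff_compactSpace.mp (isCompact_closure_range_boundedContinuousFunction _)
  exact isCompact_iff_compactSpace.mp isClosed_closure.isCompact

theorem denseRange_evalAlpha {X : Type*} [TopologicalSpace X]
    (H : Set (BoundedContinuousFunction X ℂ)) : DenseRange (evalAlpha H) := by
  intro p
  rw [closure_subtype, ← Set.range_comp]
  exact p.2

/-- Coordinates of a point of `α_H X` depend on the index in a `1`-Lipschitz way. -/
theorem dist_apply_le_of_mem_alphaSet {X : Type*} [TopologicalSpace X]
    {H : Set (BoundedContinuousFunction X ℂ)}
    {p : (h : H) → (closure (Set.range ((h : BoundedContinuousFunction X ℂ) : X → ℂ)) : Set ℂ)}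
    (hp : p ∈ alphaSet H) (g h : H) :
    dist (p g : ℂ) (p h : ℂ) ≤ dist (g : BoundedContinuousFunction X ℂ) h := by
  have hclosed : IsClosed {q : (h : H) →
      (closure (Set.range ((h : BoundedContinuousFunction X ℂ) : X → ℂ)) : Set ℂ) |
      dist (q g : ℂ) (q h : ℂ) ≤ dist (g : BoundedContinuousFunction X ℂ) h} :=
    isClosed_le (by fun_prop) continuous_const
  refine closure_minimal ?_ hclosed hp
  rintro _ ⟨x, rfl⟩
  exact BoundedContinuousFunction.dist_coe_le_dist x

/-- The restriction of coordinates `α_G X → α_H X` for `H ⊆ G`. -/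
noncomputable def alphaRestrict {X : Type*} [TopologicalSpace X]
    {H G : Set (BoundedContinuousFunction X ℂ)} (hHG : H ⊆ G) (p : alphaSet G) : alphaSet H :=
  ⟨fun h => p.1 ⟨h, hHG h.2⟩, by
    have hcont : Continuous fun (q : (g : G) →
        (closure (Set.range ((g : BoundedContinuousFunction X ℂ) : X → ℂ)) : Set ℂ)) (h : H) =>
        q ⟨h, hHG h.2⟩ := continuous_pi fun h => continuous_apply _
    refine map_mem_closure hcont p.2 ?_
    rintro _ ⟨x, rfl⟩
    exact ⟨x, rfl⟩⟩

theorem alphaRestrict_evalAlpha {X : Type*} [TopologicalSpace X]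
    {H G : Set (BoundedContinuousFunction X ℂ)} (hHG : H ⊆ G) (x : X) :
    alphaRestrict hHG (evalAlpha G x) = evalAlpha H x := rfl

theorem continuous_alphaRestrict {X : Type*} [TopologicalSpace X]
    {H G : Set (BoundedContinuousFunction X ℂ)} (hHG : H ⊆ G) :
    Continuous (alphaRestrict hHG) := by
  refine continuous_induced_rng.mpr (continuous_pi fun h => ?_)
  exact (continuous_apply (⟨h, hHG h.2⟩ : G)).comp continuous_subtype_val

theorem surjective_alphaRestrict {X : Type*} [TopologicalSpace X]
    {H G : Set (BoundedContinuousFunction X ℂ)} (hHG : H ⊆ G) :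
    Function.Surjective (alphaRestrict hHG) := by
  have := compactSpace_alphaSet G
  rw [← Set.range_eq_univ, ← (isCompact_range (continuous_alphaRestrict hHG)).isClosed.closure_eq]
  refine ((denseRange_evalAlpha H).mono ?_).closure_eq
  rintro _ ⟨x, rfl⟩
  exact ⟨evalAlpha G x, alphaRestrict_evalAlpha hHG x⟩

theorem injective_alphaRestrict {X : Type*} [TopologicalSpace X]
    {H G : Set (BoundedContinuousFunction X ℂ)} (hHG : H ⊆ G) (hGH : G ⊆ closure H) :
    Function.Injective (alphaRestrict hHG) := by
  intro p q hpq
  refine Subtype.ext (funext fun g => Subtype.ext (eq_of_forall_dist_le fun ε hε => ?_))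
  obtain ⟨h, hh, hgh⟩ := Metric.mem_closure_iff.mp (hGH g.2) (ε / 2) (half_pos hε)
  have hp := dist_apply_le_of_mem_alphaSet p.2 g ⟨h, hHG hh⟩
  have hq := dist_apply_le_of_mem_alphaSet q.2 g ⟨h, hHG hh⟩
  have heq : p.1 ⟨h, hHG hh⟩ = q.1 ⟨h, hHG hh⟩ :=
    congrFun (congrArg Subtype.val hpq) ⟨h, hh⟩
  rw [heq] at hp
  have := dist_triangle_right (p.1 g : ℂ) (q.1 g) (q.1 ⟨h, hHG hh⟩)
  linarith

/-- the closure `H̄` of `H` in `C_B(X)` (for the supremum norm) also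
separates points from closed sets, and the compactifications `α_{H̄} X` and `α_H X`
coincide: there is a homeomorphism between them which restricts to the identity on
(the canonical copies of) `X`. -/
theorem alpha_closure_eq_alpha {X : Type*} [TopologicalSpace X]
    [CompletelyRegularSpace X] [T2Space X]
    (H : Set (BoundedContinuousFunction X ℂ))
    (hsep : SeparatesPointsFromClosedSets H) :
    SeparatesPointsFromClosedSets (closure H) ∧
    ∃ φ : alphaSet (closure H) ≃ₜ alphaSet H,
      ∀ x : X, φ (evalAlpha (closure H) x) = evalAlpha H x := by
  have := compactSpace_alphaSet (closure H)
  have hhomeo : IsHomeomorph (alphaRestrict (subset_closure (s := H))) :=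
    isHomeomorph_iff_continuous_bijective.mpr ⟨continuous_alphaRestrict _,
      injective_alphaRestrict _ subset_rfl, surjective_alphaRestrict _⟩
  exact ⟨hsep.mono subset_closure, hhomeo.homeomorph, alphaRestrict_evalAlpha subset_closure⟩
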